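/- Let K be a compact Hausdorff space that is infinite dimensional. Then there is a Cantor set C contained in C(K,[0,1]) which is strongly independent. Consequently basic(K) ≥ 𝔠 = 2^ℵ0. -/

import Mathlib

open Cardinal Set Topology

noncomputable section

/-- A family `Φ ⊆ C(X)` is basic if every continuous real-valued function on `X`
is a finite sum of compositions `gᵢ ∘ φᵢ` with `φᵢ ∈ Φ` and `gᵢ ∈ C(ℝ)`. -/
def IsBasicFamily {X : Type u} [TopologicalSpace X] (Φ : Set C(X, ℝ)) : Prop :=
  ∀ f : C(X, ℝ), ∃ (m : ℕ) (φ : Fin m → C(X, ℝ)) (g : Fin m → C(ℝ, ℝ)),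
    (∀ i, φ i ∈ Φ) ∧ ∀ x, f x = ∑ i, g i (φ i x)

/-- `basic(X)`: the least cardinality of a basic family for `X`. -/
def basicCard (X : Type u) [TopologicalSpace X] : Cardinal.{u} :=
  sInf { c | ∃ Φ : Set C(X, ℝ), IsBasicFamily Φ ∧ #Φ = c }

/-- `dim X ≤ n`: every continuous map of a closed subspace of `X` into the
`n`-sphere extends continuously over `X`. -/
def DimLE (X : Type u) [TopologicalSpace X] (n : ℕ) : Prop :=
  ∀ A : Set X, IsClosed A →
    ∀ f : C(A, Metric.sphere (0 : EuclideanSpace ℝ (Fin (n + 1))) 1),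
      ∃ F : C(X, Metric.sphere (0 : EuclideanSpace ℝ (Fin (n + 1))) 1),
        ∀ a : A, F a = f a

/-- A Cantor set in `Y` is a subspace homeomorphic to the Cantor space `{0,1}^ℕ`. -/
def IsCantorSet {Y : Type u} [TopologicalSpace Y] (C : Set Y) : Prop :=
  Nonempty (C ≃ₜ (ℕ → Bool))

/-- Strong independence of a family `𝒞 ⊆ C(X)`. -/
def StronglyIndep {X : Type u} [TopologicalSpace X] (𝒞 : Set C(X, ℝ)) : Prop :=
  ∀ (n : ℕ) (φ : C(X, Fin n → ℝ)),
    #(𝒞 ∩ { f : C(X, ℝ) | ∃ g : C((Fin n → ℝ), ℝ), ∀ x, f x = g (φ x) } : Set C(X, ℝ)) ≤ n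

/-- Weak independence of a family `𝒞 ⊆ C(X)`. -/
def WeaklyIndep {X : Type u} [TopologicalSpace X] (𝒞 : Set C(X, ℝ)) : Prop :=
  ∀ (n : ℕ) (φ : Fin n → C(X, ℝ)),
    #(𝒞 ∩ { f : C(X, ℝ) | ∃ g : Fin n → C(ℝ, ℝ), ∀ x, f x = ∑ i, g i (φ i x) } : Set C(X, ℝ)) < 𝔠

/-- The weight of a topological space: least cardinality of a basis. -/
def weightCard (X : Type u) [TopologicalSpace X] : Cardinal.{u} :=
  sInf { c | ∃ B : Set (Set X), TopologicalSpace.IsTopologicalBasis B ∧ #B = c }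

/-- `cof([κ]^{ℵ₀}, ⊆)`: least cardinality of a family of countably infinite subsets
of (a set of size) `κ` which is cofinal in the countably infinite subsets. -/
def cofCtblSubsets (κ : Cardinal.{u}) : Cardinal.{u} :=
  sInf { c | ∃ 𝒞 : Set (Set κ.out),
    (∀ C ∈ 𝒞, C.Countable ∧ C.Infinite) ∧
    (∀ S : Set κ.out, S.Countable → S.Infinite → ∃ C ∈ 𝒞, S ⊆ C) ∧ #𝒞 = c }


/-- Every continuous map `K → ℝ^ι` is uniformly approximable by maps without zeros on `X`. -/
def InessentialOn (ι : Type*) {K : Type*} [TopologicalSpace K] (X : Set K) : Prop :=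
  ∀ f : C(K, ι → ℝ), ∀ ε > 0, ∃ g : C(K, ι → ℝ), (∀ x i, |g x i - f x i| < ε) ∧ ∀ x ∈ X, g x ≠ 0

namespace InessentialOn

variable {ι κ K : Type*} [TopologicalSpace K] {X Y : Set K}

theorem mono (hXY : X ⊆ Y) (h : InessentialOn ι Y) : InessentialOn ι X := fun f ε hε ↦
  let ⟨g, hg, hg0⟩ := h f ε hε
  ⟨g, hg, fun x hx ↦ hg0 x (hXY hx)⟩

theorem of_injective (h : InessentialOn ι X) {e : ι → κ} (he : Function.Injective e) :
    InessentialOn κ X := by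
  classical
  intro f ε hε
  obtain ⟨g, hg, hg0⟩ := h ⟨fun x i ↦ f x (e i), by fun_prop⟩ ε hε
  have hc : Continuous fun x (j : κ) ↦ if h : ∃ i, e i = j then g x h.choose else f x j := by
    refine continuous_pi fun j ↦ ?_
    by_cases hj : ∃ i, e i = j
    · simp only [hj, dite_true]; fun_prop
    · simp only [hj, dite_false]; fun_prop
  refine ⟨⟨_, hc⟩, fun x j ↦ ?_, fun x hx h0 ↦ hg0 x hx (funext fun i ↦ ?_)⟩
  · by_cases hj : ∃ i, e i = j
    · simpa [hj, hj.choose_spec] using hg x hj.choose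
    · simpa [hj] using hε
  · have hi : ∃ i', e i' = e i := ⟨i, rfl⟩
    have := congrFun h0 (e i)
    simp only [ContinuousMap.coe_mk, hi, dite_true] at this
    rwa [he hi.choose_spec] at this

theorem union [Fintype ι] (hX : IsCompact X) (h : InessentialOn ι X) (h' : InessentialOn ι Y) :
    InessentialOn ι (X ∪ Y) := by
  intro f ε hε
  obtain ⟨g, hg, hg0⟩ := h f (ε / 2) (half_pos hε)
  obtain ⟨δ, hδ, hδg⟩ : ∃ δ > 0, ∀ x ∈ X, δ ≤ ‖g x‖ :=
    hX.exists_forall_le' (by fun_prop) fun x hx ↦ norm_pos_iff.2 (hg0 x hx)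
  obtain ⟨k, hk, hk0⟩ := h' g (min δ (ε / 2)) (lt_min hδ (half_pos hε))
  refine ⟨k, fun x i ↦ ?_, ?_⟩
  · have h1 := hg x i
    have h2 := (hk x i).trans_le (min_le_right _ _)
    rw [abs_lt] at *
    constructor <;> linarith
  · rintro x (hx | hx) h0
    · have : ‖g x‖ < δ := (pi_norm_lt_iff hδ).2 fun i ↦ by
        simpa [h0] using (hk x i).trans_le (min_le_left _ _)
      exact this.not_ge (hδg x hx)
    · exact hk0 x hx h0

theorem fin_of_le {m n : ℕ} (hmn : m ≤ n) (h : InessentialOn (Fin m) X) :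
    InessentialOn (Fin n) X :=
  h.of_injective (Fin.castLE_injective hmn)

end InessentialOn

theorem exists_forall_nhds_not_inessentialOn {K : Type*} [TopologicalSpace K] [CompactSpace K]
    [T2Space K] (h : ∀ n, ¬ InessentialOn (Fin (n + 1)) (univ : Set K)) :
    ∃ p : K, ∀ X ∈ 𝓝 p, ∀ n, ¬ InessentialOn (Fin n) X := by
  by_contra! hK
  have key : ∃ n, InessentialOn (Fin (n + 1)) (closure (univ : Set K)) := by
    refine isCompact_univ.induction_on
      (p := fun X : Set K ↦ ∃ n, InessentialOn (Fin (n + 1)) (closure X))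
      ⟨0, fun f ε hε ↦ ⟨f, by simpa using fun _ ↦ hε, by simp⟩⟩ ?_ ?_ ?_
    · rintro s t hst ⟨n, hn⟩
      exact ⟨n, hn.mono (closure_mono hst)⟩
    · rintro s t ⟨m, hm⟩ ⟨n, hn⟩
      refine ⟨m + n, ?_⟩
      rw [closure_union]
      exact (hm.fin_of_le (by omega)).union isClosed_closure.isCompact (hn.fin_of_le (by omega))
    · intro p _
      obtain ⟨X, hX, n, hn⟩ := hK p
      obtain ⟨Y, hY, hYc, hYX⟩ := exists_mem_nhds_isClosed_subset hX
      exact ⟨Y, mem_nhdsWithin_of_mem_nhds hY, n,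
        (hn.mono (hYc.closure_eq.subset.trans hYX)).fin_of_le n.le_succ⟩
  rw [closure_univ] at key
  exact key.elim h

theorem InessentialOn.dimLE {K : Type*} [TopologicalSpace K] [CompactSpace K] [T2Space K] {n : ℕ}
    (h : InessentialOn (Fin (n + 1)) (univ : Set K)) : DimLE K n := by
  intro A hA f
  obtain ⟨F, hF⟩ := ContinuousMap.exists_restrict_eq hA
    (⟨fun a i ↦ (f a : EuclideanSpace ℝ (Fin (n + 1))) i, by fun_prop⟩ : C(A, Fin (n + 1) → ℝ))
  have hF' (a : A) : F a = (f a : EuclideanSpace ℝ (Fin (n + 1))).ofLp := DFunLike.congr_fun hF a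
  obtain ⟨c, hc, hcF⟩ : ∃ c > 0, ∀ x ∈ A, c ≤ ‖F x‖ := by
    refine hA.isCompact.exists_forall_le' (by fun_prop) fun x hx ↦ norm_pos_iff.2 fun h0 ↦ ?_
    have h1 : ‖(f ⟨x, hx⟩ : EuclideanSpace ℝ (Fin (n + 1)))‖ = 1 := by simp
    have h2 : (f ⟨x, hx⟩ : EuclideanSpace ℝ (Fin (n + 1))) = 0 := by
      ext i; simpa [h0] using (congrFun (hF' ⟨x, hx⟩) i).symm
    simp [h2] at h1
  obtain ⟨g, hg, hg0⟩ := h F (c / 2) (half_pos hc)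
  let t (x : K) : ℝ := max 0 (min 1 (2 * ‖F x‖ / c - 1))
  have ht : Continuous t := by fun_prop
  let H (x : K) : Fin (n + 1) → ℝ := g x + t x • (F x - g x)
  have hH : Continuous H := by fun_prop
  have hH0 (x : K) : H x ≠ 0 := by
    intro h0
    rcases le_or_gt ‖F x‖ (c / 2) with hx | hx
    · have : t x = 0 := max_eq_left ((min_le_right _ _).trans (by
        rw [sub_nonpos, div_le_one hc]; linarith))
      exact hg0 x (mem_univ x) (by simpa [H, this] using h0)
    · have hgF : ‖g x - F x‖ < c / 2 := (pi_norm_lt_iff (half_pos hc)).2 fun i ↦ hg x i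
      have ht0 : 0 ≤ t x := le_max_left _ _
      have ht1 : t x ≤ 1 := max_le zero_le_one (min_le_left _ _)
      have : F x = -((1 - t x) • (g x - F x)) := by
        rw [← sub_eq_zero, ← h0]; simp only [H]; module
      have : ‖F x‖ ≤ ‖g x - F x‖ := by
        conv_lhs => rw [this]
        rw [norm_neg, norm_smul, Real.norm_of_nonneg (by linarith)]
        exact mul_le_of_le_one_left (norm_nonneg _) (by linarith)
      linarith
  have hHA (a : A) : H a = F a := by
    have : t a = 1 := by
      have : 1 ≤ 2 * ‖F a‖ / c - 1 := by
        rw [le_sub_iff_add_le, le_div_iff₀ hc]; linarith [hcF a a.2]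
      simp [t, this]
    simp [H, this]
  have hn (x : K) : ‖WithLp.toLp 2 (H x)‖ ≠ 0 := by simpa using hH0 x
  refine ⟨⟨fun x ↦ ⟨‖WithLp.toLp 2 (H x)‖⁻¹ • WithLp.toLp 2 (H x), ?_⟩, ?_⟩, fun a ↦ ?_⟩
  · simp [norm_smul, hn x]
  · refine Continuous.subtype_mk (Continuous.smul (Continuous.inv₀ ?_ hn) ?_) _ <;> fun_prop
  · ext1
    simp [hHA, hF']

theorem add_clip_eq {a b c : ℝ} (h : |b - a| ≤ c) : a + max (-c) (min c (b - a)) = b := by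
  rw [min_eq_right (abs_le.1 h).2, max_eq_right (abs_le.1 h).1]; ring

theorem abs_clip_le {c : ℝ} (hc : 0 ≤ c) (v : ℝ) : |max (-c) (min c v)| ≤ c :=
  abs_le.2 ⟨le_max_left _ _, max_le (by linarith) (min_le_left _ _)⟩

/-- Every tuple of functions within `δ` of `f` attains the value `y`. -/
def IsStable {ι K : Type*} [TopologicalSpace K] [CompactSpace K] (f : ι → C(K, ℝ)) (δ : ℝ)
    (y : ι → ℝ) : Prop :=
  ∀ G : ι → C(K, ℝ), (∀ i, dist (G i) (f i) < δ) → ∃ x, ∀ i, G i x = y i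

section

variable {ι K : Type*} [TopologicalSpace K] [CompactSpace K]

theorem exists_isStable_near {p : K} (hp : ∀ X ∈ 𝓝 p, ∀ n, ¬ InessentialOn (Fin n) X) [Fintype ι]
    (f : ι → C(K, ℝ)) {ε : ℝ} (hε : 0 < ε) :
    ∃ f' : ι → C(K, ℝ), (∀ i, dist (f' i) (f i) < ε) ∧ ∃ δ > 0, ∃ y, IsStable f' δ y := by
  let X : Set K := {x | ∀ i, |f i x - f i p| < ε / 4}
  have hX : X ∈ 𝓝 p := by
    refine (isOpen_iInter_of_finite (fun i ↦ isOpen_lt (f := fun x ↦ |f i x - f i p|)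
      (by fun_prop) continuous_const)).mem_nhds (mem_iInter.2 fun i ↦ ?_) |> fun h ↦
        Filter.mem_of_superset h fun x hx i ↦ mem_iInter.1 hx i
    simpa using hε
  have hess : ¬ InessentialOn ι X := fun h ↦
    hp X hX _ (h.of_injective (Fintype.equivFin ι).injective)
  simp only [InessentialOn, not_forall, not_exists, not_and, not_not] at hess
  obtain ⟨u, δ, hδ, hu⟩ := hess
  set M : ℝ := ‖u‖ + 1 with hM
  have hM0 : 0 < M := by positivity
  have huM (x : K) (i : ι) : |u x i| ≤ M :=
    (norm_le_pi_norm (u x) i).trans ((u.norm_coe_le_norm x).trans (by linarith))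
  set η : ℝ := ε / (4 * M) with hη
  have hη0 : 0 < η := by positivity
  have hηu (x : K) (i : ι) : |η * u x i| ≤ ε / 4 := by
    rw [abs_mul, abs_of_pos hη0]
    calc η * |u x i| ≤ η * M := by gcongr; exact huM x i
      _ = ε / 4 := by rw [hη]; field_simp
  let f' (i : ι) : C(K, ℝ) :=
    ⟨fun x ↦ f i x + max (-(ε / 2)) (min (ε / 2) ((f i p + η * u x i) - f i x)), by fun_prop⟩
  have hf'X (i : ι) (x : K) (hx : x ∈ X) : f' i x = f i p + η * u x i := by
    refine add_clip_eq ?_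
    have h1 := hx i
    have h2 := hηu x i
    rw [abs_le] at *
    rw [abs_lt] at h1
    constructor <;> linarith
  refine ⟨f', fun i ↦ (ContinuousMap.dist_lt_iff hε).2 fun x ↦ ?_, η * (δ / 2), by positivity,
    fun i ↦ f i p, fun G hG ↦ ?_⟩
  · rw [Real.dist_eq]
    simp only [f', ContinuousMap.coe_mk, add_sub_cancel_left]
    exact (abs_clip_le (by positivity) _).trans_lt (by linarith)
  · obtain ⟨x, hxX, hx⟩ := hu ⟨fun x i ↦
      u x i + max (-(δ / 2)) (min (δ / 2) ((G i x - f i p) / η - u x i)), by fun_prop⟩ fun x i ↦ by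
        simp only [ContinuousMap.coe_mk, add_sub_cancel_left]
        exact (abs_clip_le (by positivity) _).trans_lt (by linarith)
    refine ⟨x, fun i ↦ ?_⟩
    have h1 := (ContinuousMap.dist_lt_iff (by positivity)).1 (hG i) x
    rw [Real.dist_eq, hf'X i x hxX] at h1
    have h2 := congrFun hx i
    simp only [ContinuousMap.coe_mk, Pi.zero_apply] at h2
    rw [add_clip_eq] at h2
    · rcases div_eq_zero_iff.1 h2 with h | h
      · linarith
      · exact absurd h hη0.ne'
    · have : (G i x - f i p) / η - u x i = (G i x - (f i p + η * u x i)) / η := by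
        field_simp; ring
      rw [this, abs_div, abs_of_pos hη0, div_le_iff₀ hη0]
      linarith

theorem exists_near_comp_forall_ne [Fintype ι] {m : ℕ} (hm : m < Fintype.card ι)
    (φ : C(K, Fin m → ℝ)) (g : ι → C(Fin m → ℝ, ℝ)) (y : ι → ℝ) {ε : ℝ} (hε : 0 < ε) :
    ∃ G : ι → C(K, ℝ), (∀ i, dist (G i) ((g i).comp φ) < ε) ∧ ∀ x, ∃ i, G i x ≠ y i := by
  obtain ⟨h, hh, hhg, -⟩ := Continuous.exists_contDiff_approx (f := fun v i ↦ g i v)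
    (ε := fun _ ↦ ε / 2) 1 (by fun_prop) continuous_const fun _ ↦ half_pos hε
  obtain ⟨z, hz, hzy⟩ := (hh.dense_compl_range_of_finrank_lt_finrank
    (by simpa using hm)).exists_dist_lt y (half_pos hε)
  have hhc := hh.continuous
  refine ⟨fun i ↦ ⟨fun x ↦ h (φ x) i + (y i - z i), by fun_prop⟩,
    fun i ↦ (ContinuousMap.dist_lt_iff hε).2 fun x ↦ ?_, fun x ↦ ?_⟩
  · have h1 := (dist_le_pi_dist _ _ i).trans_lt (hhg (φ x))
    have h2 := (dist_le_pi_dist _ _ i).trans_lt hzy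
    rw [Real.dist_eq, abs_lt] at *
    simp only [ContinuousMap.coe_mk, ContinuousMap.comp_apply]
    constructor <;> linarith
  · by_contra! hx
    refine hz ⟨φ x, funext fun i ↦ ?_⟩
    have := hx i
    simp only [ContinuousMap.coe_mk] at this
    linarith

end

/-- Extend a finite binary word by `false`. -/
def padFalse {N : ℕ} (s : Fin N → Bool) (i : ℕ) : Bool := if h : i < N then s ⟨i, h⟩ else false

theorem padFalse_apply {N : ℕ} (s : Fin N → Bool) (i : Fin N) : padFalse s i = s i := by
  simp [padFalse]

theorem exists_forall_dist_lt_of_forall_lt_eq {E : Type*} [PseudoMetricSpace E]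
    (F : C(ℕ → Bool, E)) (n : ℕ)
    {ε : ℝ} (hε : 0 < ε) :
    ∃ N ≥ n, ∀ x y : ℕ → Bool, (∀ i < N, x i = y i) → dist (F x) (F y) < ε := by
  have hU := CompactSpace.uniformContinuous_of_continuous F.continuous
    (Metric.dist_mem_uniformity hε)
  rw [Filter.mem_map, Pi.uniformity, Filter.mem_iInf] at hU
  obtain ⟨I, hI, V, hV, hIV⟩ := hU
  obtain ⟨N, hN⟩ := hI.bddAbove
  refine ⟨max n (N + 1), le_max_left _ _, fun x y hxy ↦ ?_⟩
  have : (x, y) ∈ ⋂ i, V i := mem_iInter.2 fun i ↦ by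
    obtain ⟨W, hW, hWV⟩ := hV i
    refine hWV ?_
    simp only [mem_preimage]
    rw [hxy i (lt_max_of_lt_right (Nat.lt_succ_of_le (hN i.2)))]
    exact refl_mem_uniformity hW
  rw [← hIV] at this
  exact this

section

variable {K : Type*} [TopologicalSpace K] [CompactSpace K]

/-- Cantor schemes `F` of functions whose restriction to any choice of representatives of the
`N`-cylinders is stable, with common stability data. -/
def stableAtLevel (K : Type*) [TopologicalSpace K] [CompactSpace K] (N : ℕ) :
    Set C(ℕ → Bool, C(K, ℝ)) :=
  {F | ∃ δ > 0, ∃ y, ∀ x : (Fin N → Bool) → ℕ → Bool, (∀ s (i : Fin N), x s i = s i) →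
    IsStable (fun s ↦ F (x s)) δ y}

theorem isOpen_stableAtLevel (N : ℕ) : IsOpen (stableAtLevel K N) := by
  refine Metric.isOpen_iff.2 fun F ⟨δ, hδ, y, hF⟩ ↦ ⟨δ / 2, half_pos hδ, fun F' hF' ↦
    ⟨δ / 2, half_pos hδ, y, fun x hx G hG ↦ hF x hx G fun s ↦ ?_⟩⟩
  have := (ContinuousMap.dist_lt_iff (half_pos hδ)).1 hF' (x s)
  linarith [dist_triangle (G s) (F' (x s)) (F (x s)), hG s]

theorem dense_iUnion_stableAtLevel {p : K} (hp : ∀ X ∈ 𝓝 p, ∀ n, ¬ InessentialOn (Fin n) X)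
    (n : ℕ) : Dense (⋃ N ≥ n, stableAtLevel K N) := by
  refine Metric.dense_iff.2 fun F ε hε ↦ ?_
  obtain ⟨N, hN, hNF⟩ := exists_forall_dist_lt_of_forall_lt_eq F n (half_pos hε)
  obtain ⟨f, hf, δ, hδ, y, hfy⟩ :=
    exists_isStable_near hp (fun s : Fin N → Bool ↦ F (padFalse s)) (half_pos hε)
  refine ⟨⟨fun x ↦ f fun i ↦ x i, continuous_of_discreteTopology.comp (by fun_prop)⟩,
    (ContinuousMap.dist_lt_iff hε).2 fun x ↦ ?_, mem_iUnion₂.2 ⟨N, hN, δ, hδ, y, fun x hx ↦ ?_⟩⟩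
  · have h1 := hf fun i ↦ x i
    have h2 := hNF (padFalse fun i : Fin N ↦ x i) x fun i hi ↦ padFalse_apply _ ⟨i, hi⟩
    exact (dist_triangle _ (F (padFalse fun i : Fin N ↦ x i)) _).trans_lt
      ((add_lt_add h1 h2).trans_eq (add_halves ε))
  · simpa [hx] using hfy

theorem exists_forall_mem_stableAtLevel {p : K}
    (hp : ∀ X ∈ 𝓝 p, ∀ n, ¬ InessentialOn (Fin n) X) (F₀ : C(ℕ → Bool, C(K, ℝ))) {ε : ℝ}
    (hε : 0 < ε) :
    ∃ F : C(ℕ → Bool, C(K, ℝ)), dist F F₀ < ε ∧ ∀ n, ∃ N ≥ n, F ∈ stableAtLevel K N := by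
  obtain ⟨F, hF, hd⟩ := (dense_iInter_of_isOpen
    (fun n ↦ isOpen_biUnion fun N (_ : N ≥ n) ↦ isOpen_stableAtLevel (K := K) N)
    (dense_iUnion_stableAtLevel hp)).exists_dist_lt F₀ hε
  exact ⟨F, by rwa [dist_comm], fun n ↦
    let ⟨N, hN, h⟩ := mem_iUnion₂.1 (mem_iInter.1 hF n)
    ⟨N, hN, h⟩⟩

theorem not_factors_of_stableAtLevel {F : C(ℕ → Bool, C(K, ℝ))}
    (hF : ∀ n, ∃ N ≥ n, F ∈ stableAtLevel K N) {m : ℕ} {x : Fin (m + 1) → ℕ → Bool}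
    (hx : Function.Injective x) (φ : C(K, Fin m → ℝ)) (g : Fin (m + 1) → C(Fin m → ℝ, ℝ)) :
    ¬ ∀ i, F (x i) = (g i).comp φ := by
  intro hg
  have hsep (q : Fin (m + 1) × Fin (m + 1)) : ∃ k, q.1 ≠ q.2 → x q.1 k ≠ x q.2 k := by
    by_cases hq : q.1 = q.2
    · exact ⟨0, fun h ↦ absurd hq h⟩
    · exact (Function.ne_iff.1 (hx.ne hq)).imp fun _ h _ ↦ h
  choose k hk using hsep
  obtain ⟨N, hN, δ, hδ, y, hy⟩ := hF (Finset.univ.sup k + 1)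
  let e (i : Fin (m + 1)) (l : Fin N) : Bool := x i l
  have he : Function.Injective e := fun i j hij ↦ by
    by_contra hne
    have hlt : k (i, j) < N :=
      (Nat.lt_succ_of_le (Finset.le_sup (Finset.mem_univ (i, j)))).trans_le hN
    exact hk (i, j) hne (congrFun hij ⟨_, hlt⟩)
  obtain ⟨G, hG, hGy⟩ := exists_near_comp_forall_ne (by simp) φ g (y ∘ e) hδ
  obtain ⟨z, hz⟩ := hy (Function.extend e x padFalse) (fun s l ↦ by
      by_cases hs : ∃ i, e i = s
      · obtain ⟨i, rfl⟩ := hs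
        rw [he.extend_apply]
      · rw [Function.extend_apply' _ _ _ hs, padFalse_apply])
    (Function.extend e G fun s ↦ F (padFalse s)) fun s ↦ by
      by_cases hs : ∃ i, e i = s
      · obtain ⟨i, rfl⟩ := hs
        simpa only [he.extend_apply, hg] using hG i
      · simpa [Function.extend_apply' _ _ _ hs] using hδ
  obtain ⟨i, hi⟩ := hGy z
  exact hi (by simpa [he.extend_apply] using hz (e i))

theorem injective_of_stableAtLevel {F : C(ℕ → Bool, C(K, ℝ))}
    (hF : ∀ n, ∃ N ≥ n, F ∈ stableAtLevel K N) : Function.Injective F := by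
  intro a b hab
  by_contra hne
  refine not_factors_of_stableAtLevel hF (m := 1) (x := ![a, b]) ?_
    ⟨fun z _ ↦ F a z, by fun_prop⟩ (fun _ ↦ ⟨fun v ↦ v 0, by fun_prop⟩) fun i ↦ ?_
  · intro i j; fin_cases i <;> fin_cases j <;> simp [hne, Ne.symm hne]
  · ext z; fin_cases i <;> simp [hab]

end

theorem stronglyIndep_range {K : Type u} [TopologicalSpace K] [CompactSpace K]
    {F : C(ℕ → Bool, C(K, ℝ))} (hF : ∀ n, ∃ N ≥ n, F ∈ stableAtLevel K N) :
    StronglyIndep (range F) := by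
  intro m φ
  by_contra! h
  have h' : lift.{u} #(Fin (m + 1)) ≤ lift.{0} #(range F ∩ { f : C(K, ℝ) | ∃ g : C((Fin m → ℝ), ℝ),
      ∀ x, f x = g (φ x) } : Set C(K, ℝ)) := by
    simpa using Order.succ_le_of_lt h
  obtain ⟨e⟩ := Cardinal.lift_mk_le'.1 h'
  have hex (i : Fin (m + 1)) : ∃ x, F x = (e i).1 := (e i).2.1
  choose x hx using hex
  choose g hg using fun i ↦ (e i).2.2
  refine not_factors_of_stableAtLevel hF (x := x) (fun i j hij ↦ e.injective (Subtype.ext ?_)) φ g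
    fun i ↦ ?_
  · rw [← hx i, ← hx j, hij]
  · ext z; rw [hx i, hg i]; rfl

theorem StronglyIndep.mk_le_of_isBasicFamily {X : Type u} [TopologicalSpace X] {C Φ : Set C(X, ℝ)}
    (hC : StronglyIndep C) (hΦ : IsBasicFamily Φ) : #C ≤ max ℵ₀ #Φ := by
  choose m φ g hφ hg using hΦ
  let T (f : C) : List Φ := List.ofFn fun i : Fin (m f) ↦ ⟨φ f i, hφ f i⟩
  have hT (l : List Φ) : #(T ⁻¹' {l}) ≤ ℵ₀ := by
    refine le_trans ?_ ((hC l.length ⟨fun x i ↦ (l.get i : C(X, ℝ)) x, by fun_prop⟩).trans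
      natCast_le_aleph0)
    rw [← mk_image_eq Subtype.val_injective]
    refine mk_le_mk_of_subset ?_
    rintro _ ⟨f, rfl, rfl⟩
    have hl : m f = (T f).length := by simp [T]
    refine ⟨f.2, ⟨fun v ↦ ∑ i, g f i (v (Fin.cast hl i)), by fun_prop⟩, fun x ↦ ?_⟩
    simp [hg f.1 x, T]
  calc #C ≤ #(List Φ) * ℵ₀ := mk_le_mk_mul_of_mk_preimage_le T hT
    _ ≤ max ℵ₀ #Φ * max ℵ₀ #Φ := mul_le_mul' (mk_list_le_max _) (le_max_left _ _)
    _ = max ℵ₀ #Φ := mul_eq_self (le_max_left _ _)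

theorem isBasicFamily_univ (X : Type u) [TopologicalSpace X] :
    IsBasicFamily (univ : Set C(X, ℝ)) :=
  fun f ↦ ⟨1, fun _ ↦ f, fun _ ↦ .id ℝ, by simp, by simp⟩

theorem StronglyIndep.continuum_le_basicCard {X : Type} [TopologicalSpace X] {C : Set C(X, ℝ)}
    (hC : StronglyIndep C) (hCantor : IsCantorSet C) : 𝔠 ≤ basicCard X := by
  refine le_csInf ⟨_, _, isBasicFamily_univ X, rfl⟩ ?_
  rintro _ ⟨Φ, hΦ, rfl⟩
  have hc : 𝔠 ≤ #C := by
    rw [hCantor.some.toEquiv.cardinal_eq]; simp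
  exact (le_max_iff.1 (hc.trans (hC.mk_le_of_isBasicFamily hΦ))).resolve_left
    aleph0_lt_continuum.not_ge

theorem stmt7 (K : Type) [TopologicalSpace K] [CompactSpace K] [T2Space K]
    (hdim : ∀ n, ¬ DimLE K n) :
    ∃ C : Set C(K, ℝ), (∀ f ∈ C, ∀ x, f x ∈ Set.Icc (0:ℝ) 1) ∧
      IsCantorSet C ∧ StronglyIndep C ∧ 𝔠 ≤ basicCard K := by
  obtain ⟨p, hp⟩ := exists_forall_nhds_not_inessentialOn fun n h ↦ hdim n h.dimLE
  obtain ⟨F, hF, hFs⟩ := exists_forall_mem_stableAtLevel hp (.const _ (.const _ (1 / 2)))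
    (half_pos one_pos)
  have hemb : IsEmbedding F :=
    (F.continuous.isClosedEmbedding (injective_of_stableAtLevel hFs)).isEmbedding
  have hCantor : IsCantorSet (range F) := ⟨hemb.toHomeomorph.symm⟩
  have hind := stronglyIndep_range hFs
  refine ⟨range F, ?_, hCantor, hind, hind.continuum_le_basicCard hCantor⟩
  rintro _ ⟨x, rfl⟩ z
  have h1 := ContinuousMap.dist_apply_le_dist (f := F x) (g := .const _ (1 / 2)) z
  have h2 := ContinuousMap.dist_apply_le_dist (f := F) (g := .const _ (.const _ (1 / 2))) x
  have h3 := (h1.trans h2).trans_lt hF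
  rw [Real.dist_eq, ContinuousMap.const_apply, abs_lt] at h3
  constructor <;> linarith

end
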